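/- Six-term sequence of the cone extension (covariant case): Let F be an additive, homotopy invariant, half-exact covariant functor from C*-algebras to abelian groups, and let A be a C*-algebra. Consider the extension e : SA →ι CA →ev₁ A, where ι is the inclusion and ev₁ is evaluation at 1, with mapping cone C_{ev₁} = {(x,y) ∈ CA ⊕ CA : x(1) = y(1)}, and the two *-homomorphisms f : SA → C_{ev₁}, g ↦ (g, 0), and ι_mc : SA → C_{ev₁}, g ↦ (0, g). Then: (1) F(CA) and F(S(CA)) are the trivial group; (2) F(f) = −F(ι_mc) as homomorphisms F(SA) → F(C_{ev₁}); and (3) F(Sf) = −F(Sι_mc) as homomorphisms F(S(SA)) → F(S(C_{ev₁})). (In the notation of the paper, this says that the standard cyclic six-term sequence associated to e has ∂₁ = −id and ∂₀ = −β_A.) -/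

import Mathlib

/-!
Formalization preamble: cones, suspensions, mapping cones of (non-unital) C*-algebras,
their concrete models inside algebras of continuous functions, and functors from
C*-algebras to abelian groups.
-/

set_option maxHeartbeats 1600000
set_option synthInstance.maxHeartbeats 800000

open scoped unitInterval CStarAlgebra

noncomputable section

namespace CStarPaper

variable {A B : Type*} [NonUnitalCStarAlgebra A] [NonUnitalCStarAlgebra B]

/-- The flip of a continuous function on the square `[0,1]²`. -/
def flip2 {A : Type*} [NonUnitalCStarAlgebra A] (f : C(I × I, A)) : C(I × I, A) :=
  f.comp ⟨Prod.swap, continuous_swap⟩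

@[simp] lemma flip2_apply (f : C(I × I, A)) (s t : I) : flip2 f (s, t) = f (t, s) := rfl

/-- The cone `CA = {f ∈ C([0,1],A) : f(0) = 0}` of a C*-algebra `A`. -/
def cone (A : Type*) [NonUnitalCStarAlgebra A] : NonUnitalStarSubalgebra ℂ C(I, A) where
  carrier := {f | f 0 = 0}
  add_mem' := by intro f g hf hg; simp_all [Set.mem_setOf_eq]
  zero_mem' := by simp [Set.mem_setOf_eq]
  mul_mem' := by intro f g hf hg; simp_all [Set.mem_setOf_eq]
  smul_mem' := by intro c f hf; simp_all [Set.mem_setOf_eq]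
  star_mem' := by intro f hf; simp_all [Set.mem_setOf_eq, map_star]

instance cone.isClosed (A : Type*) [NonUnitalCStarAlgebra A] :
    IsClosed ((cone A : Set C(I, A))) :=
  isClosed_eq (continuous_eval_const 0) continuous_const

/-- The suspension `SA = {f ∈ C([0,1],A) : f(0) = f(1) = 0}` of a C*-algebra `A`. -/
def susp (A : Type*) [NonUnitalCStarAlgebra A] : NonUnitalStarSubalgebra ℂ C(I, A) where
  carrier := {f | f 0 = 0 ∧ f 1 = 0}
  add_mem' := by intro f g hf hg; simp_all [Set.mem_setOf_eq]
  zero_mem' := by simp [Set.mem_setOf_eq]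
  mul_mem' := by intro f g hf hg; simp_all [Set.mem_setOf_eq]
  smul_mem' := by intro c f hf; simp_all [Set.mem_setOf_eq]
  star_mem' := by intro f hf; simp_all [Set.mem_setOf_eq, map_star]

instance susp.isClosed (A : Type*) [NonUnitalCStarAlgebra A] :
    IsClosed ((susp A : Set C(I, A))) := by
  have h : (susp A : Set C(I, A)) = {f | f 0 = 0} ∩ {f | f 1 = 0} := rfl
  rw [h]
  exact (isClosed_eq (continuous_eval_const 0) continuous_const).inter
    (isClosed_eq (continuous_eval_const 1) continuous_const)

/-- The mapping cone `C_φ = {(x,y) ∈ A ⊕ CB : φ(x) = y(1)}` of `φ : A → B`. -/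
def mapCone (φ : A →⋆ₙₐ[ℂ] B) : NonUnitalStarSubalgebra ℂ (A × C(I, B)) where
  carrier := {p | p.2 0 = 0 ∧ φ p.1 = p.2 1}
  add_mem' := by intro p q hp hq; simp_all [Set.mem_setOf_eq]
  zero_mem' := by simp [Set.mem_setOf_eq]
  mul_mem' := by intro p q hp hq; simp_all [Set.mem_setOf_eq]
  smul_mem' := by intro c p hp; simp_all [Set.mem_setOf_eq]
  star_mem' := by intro p hp; simp_all [Set.mem_setOf_eq, map_star]

instance mapCone.isClosed (φ : A →⋆ₙₐ[ℂ] B) :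
    IsClosed ((mapCone φ : Set (A × C(I, B)))) := by
  have h : (mapCone φ : Set (A × C(I, B)))
      = {p : A × C(I, B) | p.2 0 = 0} ∩ {p : A × C(I, B) | φ p.1 = p.2 1} := rfl
  rw [h]
  exact (isClosed_eq ((continuous_eval_const 0).comp continuous_snd) continuous_const).inter
    (isClosed_eq ((map_continuous φ).comp continuous_fst)
      ((continuous_eval_const 1).comp continuous_snd))

/-- The canonical inclusion `SA → CA`. -/
def suspIncl (A : Type*) [NonUnitalCStarAlgebra A] : ↥(susp A) →⋆ₙₐ[ℂ] ↥(cone A) where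
  toFun f := ⟨(f : C(I, A)), f.2.1⟩
  map_smul' _ _ := rfl
  map_zero' := rfl
  map_add' _ _ := rfl
  map_mul' _ _ := rfl
  map_star' _ := rfl

/-- Evaluation at `1`, as a *-homomorphism `CA → A`. -/
def coneEval (A : Type*) [NonUnitalCStarAlgebra A] : ↥(cone A) →⋆ₙₐ[ℂ] A where
  toFun f := (f : C(I, A)) 1
  map_smul' _ _ := rfl
  map_zero' := rfl
  map_add' _ _ := rfl
  map_mul' _ _ := rfl
  map_star' _ := rfl

/-- The canonical projection `π_mc : C_φ → A`, `(x,y) ↦ x`. -/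
def mapConeProj (φ : A →⋆ₙₐ[ℂ] B) : ↥(mapCone φ) →⋆ₙₐ[ℂ] A where
  toFun p := (p : A × C(I, B)).1
  map_smul' _ _ := rfl
  map_zero' := rfl
  map_add' _ _ := rfl
  map_mul' _ _ := rfl
  map_star' _ := rfl

/-- The projection `C_φ → CB`, `(x,y) ↦ y`. -/
def mapConeSnd (φ : A →⋆ₙₐ[ℂ] B) : ↥(mapCone φ) →⋆ₙₐ[ℂ] ↥(cone B) where
  toFun p := ⟨(p : A × C(I, B)).2, p.2.1⟩
  map_smul' _ _ := rfl
  map_zero' := rfl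
  map_add' _ _ := rfl
  map_mul' _ _ := rfl
  map_star' _ := rfl

/-- The canonical inclusion `ι_mc : SB → C_φ`, `g ↦ (0,g)`. -/
def mapConeIncl (φ : A →⋆ₙₐ[ℂ] B) : ↥(susp B) →⋆ₙₐ[ℂ] ↥(mapCone φ) where
  toFun g := ⟨(0, (g : C(I, B))), ⟨g.2.1, by simp [g.2.2]⟩⟩
  map_smul' c g := Subtype.ext (by simp [Prod.ext_iff])
  map_zero' := Subtype.ext (by simp [Prod.ext_iff])
  map_add' g h := Subtype.ext (by simp [Prod.ext_iff])
  map_mul' g h := Subtype.ext (by simp [Prod.ext_iff])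
  map_star' g := Subtype.ext (by simp [Prod.ext_iff])

/-- The concrete model of the suspension `S(C_φ)` of a mapping cone, inside
`C([0,1],A) × C([0,1]²,B)`. -/
def suspMapConeModel (φ : A →⋆ₙₐ[ℂ] B) :
    NonUnitalStarSubalgebra ℂ (C(I, A) × C(I × I, B)) where
  carrier := {p | p.1 0 = 0 ∧ p.1 1 = 0 ∧ (∀ t, p.2 (0, t) = 0) ∧ (∀ t, p.2 (1, t) = 0) ∧
    (∀ s, p.2 (s, 0) = 0) ∧ ∀ s, φ (p.1 s) = p.2 (s, 1)}
  add_mem' := by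
    rintro p q ⟨h1, h2, h3, h4, h5, h6⟩ ⟨g1, g2, g3, g4, g5, g6⟩
    exact ⟨by simp [h1, g1], by simp [h2, g2], fun t => by simp [h3 t, g3 t],
      fun t => by simp [h4 t, g4 t], fun s => by simp [h5 s, g5 s],
      fun s => by simp [h6 s, g6 s]⟩
  zero_mem' := ⟨by simp, by simp, fun t => by simp, fun t => by simp, fun s => by simp,
    fun s => by simp⟩
  mul_mem' := by
    rintro p q ⟨h1, h2, h3, h4, h5, h6⟩ ⟨g1, g2, g3, g4, g5, g6⟩
    exact ⟨by simp [h1, g1], by simp [h2, g2], fun t => by simp [h3 t, g3 t],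
      fun t => by simp [h4 t, g4 t], fun s => by simp [h5 s, g5 s],
      fun s => by simp [h6 s, g6 s]⟩
  smul_mem' := by
    rintro c p ⟨h1, h2, h3, h4, h5, h6⟩
    exact ⟨by simp [h1], by simp [h2], fun t => by simp [h3 t],
      fun t => by simp [h4 t], fun s => by simp [h5 s], fun s => by simp [h6 s]⟩
  star_mem' := by
    rintro p ⟨h1, h2, h3, h4, h5, h6⟩
    exact ⟨by simp [h1], by simp [h2], fun t => by simp [h3 t],
      fun t => by simp [h4 t], fun s => by simp [h5 s], fun s => by simp [map_star, h6 s]⟩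

/-- The concrete model of the mapping cone `C_{Sφ}` of the suspension of `φ`, inside
`C([0,1],A) × C([0,1]²,B)`. -/
def mapConeSuspModel (φ : A →⋆ₙₐ[ℂ] B) :
    NonUnitalStarSubalgebra ℂ (C(I, A) × C(I × I, B)) where
  carrier := {p | p.1 0 = 0 ∧ p.1 1 = 0 ∧ (∀ t, p.2 (0, t) = 0) ∧ (∀ s, p.2 (s, 0) = 0) ∧
    (∀ s, p.2 (s, 1) = 0) ∧ ∀ t, φ (p.1 t) = p.2 (1, t)}
  add_mem' := by
    rintro p q ⟨h1, h2, h3, h4, h5, h6⟩ ⟨g1, g2, g3, g4, g5, g6⟩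
    exact ⟨by simp [h1, g1], by simp [h2, g2], fun t => by simp [h3 t, g3 t],
      fun s => by simp [h4 s, g4 s], fun s => by simp [h5 s, g5 s],
      fun t => by simp [h6 t, g6 t]⟩
  zero_mem' := ⟨by simp, by simp, fun t => by simp, fun s => by simp, fun s => by simp,
    fun t => by simp⟩
  mul_mem' := by
    rintro p q ⟨h1, h2, h3, h4, h5, h6⟩ ⟨g1, g2, g3, g4, g5, g6⟩
    exact ⟨by simp [h1, g1], by simp [h2, g2], fun t => by simp [h3 t, g3 t],
      fun s => by simp [h4 s, g4 s], fun s => by simp [h5 s, g5 s],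
      fun t => by simp [h6 t, g6 t]⟩
  smul_mem' := by
    rintro c p ⟨h1, h2, h3, h4, h5, h6⟩
    exact ⟨by simp [h1], by simp [h2], fun t => by simp [h3 t],
      fun s => by simp [h4 s], fun s => by simp [h5 s], fun t => by simp [h6 t]⟩
  star_mem' := by
    rintro p ⟨h1, h2, h3, h4, h5, h6⟩
    exact ⟨by simp [h1], by simp [h2], fun t => by simp [h3 t],
      fun s => by simp [h4 s], fun s => by simp [h5 s], fun t => by simp [map_star, h6 t]⟩

/-- The concrete model of the cone `C(C_φ)` of a mapping cone, inside
`C([0,1],A) × C([0,1]²,B)`. -/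
def coneMapConeModel (φ : A →⋆ₙₐ[ℂ] B) :
    NonUnitalStarSubalgebra ℂ (C(I, A) × C(I × I, B)) where
  carrier := {p | p.1 0 = 0 ∧ (∀ t, p.2 (0, t) = 0) ∧ (∀ s, p.2 (s, 0) = 0) ∧
    ∀ s, φ (p.1 s) = p.2 (s, 1)}
  add_mem' := by
    rintro p q ⟨h1, h3, h5, h6⟩ ⟨g1, g3, g5, g6⟩
    exact ⟨by simp [h1, g1], fun t => by simp [h3 t, g3 t], fun s => by simp [h5 s, g5 s],
      fun s => by simp [h6 s, g6 s]⟩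
  zero_mem' := ⟨by simp, fun t => by simp, fun s => by simp, fun s => by simp⟩
  mul_mem' := by
    rintro p q ⟨h1, h3, h5, h6⟩ ⟨g1, g3, g5, g6⟩
    exact ⟨by simp [h1, g1], fun t => by simp [h3 t, g3 t], fun s => by simp [h5 s, g5 s],
      fun s => by simp [h6 s, g6 s]⟩
  smul_mem' := by
    rintro c p ⟨h1, h3, h5, h6⟩
    exact ⟨by simp [h1], fun t => by simp [h3 t], fun s => by simp [h5 s],
      fun s => by simp [h6 s]⟩
  star_mem' := by
    rintro p ⟨h1, h3, h5, h6⟩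
    exact ⟨by simp [h1], fun t => by simp [h3 t], fun s => by simp [h5 s],
      fun s => by simp [map_star, h6 s]⟩

/-- The concrete model of the mapping cone `C_{Cφ}` of the cone of `φ`, inside
`C([0,1],A) × C([0,1]²,B)`. -/
def mapConeConeModel (φ : A →⋆ₙₐ[ℂ] B) :
    NonUnitalStarSubalgebra ℂ (C(I, A) × C(I × I, B)) where
  carrier := {p | p.1 0 = 0 ∧ (∀ t, p.2 (0, t) = 0) ∧ (∀ s, p.2 (s, 0) = 0) ∧
    ∀ t, φ (p.1 t) = p.2 (1, t)}
  add_mem' := by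
    rintro p q ⟨h1, h3, h5, h6⟩ ⟨g1, g3, g5, g6⟩
    exact ⟨by simp [h1, g1], fun t => by simp [h3 t, g3 t], fun s => by simp [h5 s, g5 s],
      fun t => by simp [h6 t, g6 t]⟩
  zero_mem' := ⟨by simp, fun t => by simp, fun s => by simp, fun t => by simp⟩
  mul_mem' := by
    rintro p q ⟨h1, h3, h5, h6⟩ ⟨g1, g3, g5, g6⟩
    exact ⟨by simp [h1, g1], fun t => by simp [h3 t, g3 t], fun s => by simp [h5 s, g5 s],
      fun t => by simp [h6 t, g6 t]⟩
  smul_mem' := by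
    rintro c p ⟨h1, h3, h5, h6⟩
    exact ⟨by simp [h1], fun t => by simp [h3 t], fun s => by simp [h5 s],
      fun t => by simp [h6 t]⟩
  star_mem' := by
    rintro p ⟨h1, h3, h5, h6⟩
    exact ⟨by simp [h1], fun t => by simp [h3 t], fun s => by simp [h5 s],
      fun t => by simp [map_star, h6 t]⟩

variable {X Y₁ Y₂ Z : Type*} [NonUnitalCStarAlgebra X] [NonUnitalCStarAlgebra Y₁]
  [NonUnitalCStarAlgebra Y₂] [NonUnitalCStarAlgebra Z]

/-- The canonical concrete realization of the double mapping cone associated to a commuting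
square `ψ₁ ∘ φ₁ = ψ₂ ∘ φ₂`, inside `X × C([0,1],Y₁) × C([0,1],Y₂) × C([0,1]²,Z)`. -/
def dblCone (φ₁ : X →⋆ₙₐ[ℂ] Y₁) (φ₂ : X →⋆ₙₐ[ℂ] Y₂) (ψ₁ : Y₁ →⋆ₙₐ[ℂ] Z) (ψ₂ : Y₂ →⋆ₙₐ[ℂ] Z) :
    NonUnitalStarSubalgebra ℂ (X × C(I, Y₁) × C(I, Y₂) × C(I × I, Z)) where
  carrier := {p | p.2.1 0 = 0 ∧ p.2.2.1 0 = 0 ∧ (∀ t, p.2.2.2 (0, t) = 0) ∧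
    (∀ s, p.2.2.2 (s, 0) = 0) ∧ φ₁ p.1 = p.2.1 1 ∧ φ₂ p.1 = p.2.2.1 1 ∧
    (∀ t, ψ₁ (p.2.1 t) = p.2.2.2 (1, t)) ∧ ∀ s, ψ₂ (p.2.2.1 s) = p.2.2.2 (s, 1)}
  add_mem' := by
    rintro p q ⟨h1, h2, h3, h4, h5, h6, h7, h8⟩ ⟨g1, g2, g3, g4, g5, g6, g7, g8⟩
    exact ⟨by simp [h1, g1], by simp [h2, g2], fun t => by simp [h3 t, g3 t],
      fun s => by simp [h4 s, g4 s], by simp [h5, g5], by simp [h6, g6],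
      fun t => by simp [h7 t, g7 t], fun s => by simp [h8 s, g8 s]⟩
  zero_mem' := ⟨by simp, by simp, fun t => by simp, fun s => by simp, by simp, by simp,
    fun t => by simp, fun s => by simp⟩
  mul_mem' := by
    rintro p q ⟨h1, h2, h3, h4, h5, h6, h7, h8⟩ ⟨g1, g2, g3, g4, g5, g6, g7, g8⟩
    exact ⟨by simp [h1, g1], by simp [h2, g2], fun t => by simp [h3 t, g3 t],
      fun s => by simp [h4 s, g4 s], by simp [h5, g5], by simp [h6, g6],
      fun t => by simp [h7 t, g7 t], fun s => by simp [h8 s, g8 s]⟩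
  smul_mem' := by
    rintro c p ⟨h1, h2, h3, h4, h5, h6, h7, h8⟩
    exact ⟨by simp [h1], by simp [h2], fun t => by simp [h3 t], fun s => by simp [h4 s],
      by simp [h5], by simp [h6], fun t => by simp [h7 t], fun s => by simp [h8 s]⟩
  star_mem' := by
    rintro p ⟨h1, h2, h3, h4, h5, h6, h7, h8⟩
    exact ⟨by simp [h1], by simp [h2], fun t => by simp [h3 t], fun s => by simp [h4 s],
      by simp [map_star, h5], by simp [map_star, h6], fun t => by simp [map_star, h7 t],
      fun s => by simp [map_star, h8 s]⟩

/-- The pullback of two *-homomorphisms with common codomain, as a *-subalgebra of the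
direct sum. -/
def pullbackAlg {B₂ C₁ C₂ : Type*} [NonUnitalCStarAlgebra B₂] [NonUnitalCStarAlgebra C₁]
    [NonUnitalCStarAlgebra C₂] (v : B₂ →⋆ₙₐ[ℂ] C₂) (w : C₁ →⋆ₙₐ[ℂ] C₂) :
    NonUnitalStarSubalgebra ℂ (B₂ × C₁) where
  carrier := {p | v p.1 = w p.2}
  add_mem' := by intro p q hp hq; simp_all [Set.mem_setOf_eq]
  zero_mem' := by simp [Set.mem_setOf_eq]
  mul_mem' := by intro p q hp hq; simp_all [Set.mem_setOf_eq]
  smul_mem' := by intro c p hp; simp_all [Set.mem_setOf_eq]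
  star_mem' := by intro p hp; simp_all [Set.mem_setOf_eq, map_star]

/-- `ι, π` form a short exact sequence. -/
def IsShortExact {A₀ A₁ A₂ : Type*}
    [NonUnitalNonAssocSemiring A₀] [NonUnitalNonAssocSemiring A₁] [NonUnitalNonAssocSemiring A₂]
    [DistribMulAction ℂ A₀] [DistribMulAction ℂ A₁] [DistribMulAction ℂ A₂]
    [Star A₀] [Star A₁] [Star A₂]
    (ι : A₀ →⋆ₙₐ[ℂ] A₁) (π : A₁ →⋆ₙₐ[ℂ] A₂) : Prop :=
  Function.Injective ι ∧ Function.Surjective π ∧ Set.range ι = {b | π b = 0}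

/-- A covariant functor from (non-unital) C*-algebras to abelian groups. -/
structure AbFunctor where
  obj : (A : Type) → [NonUnitalCStarAlgebra A] → Type
  grp : (A : Type) → [NonUnitalCStarAlgebra A] → AddCommGroup (obj A)
  map : {A B : Type} → [NonUnitalCStarAlgebra A] → [NonUnitalCStarAlgebra B] →
    (A →⋆ₙₐ[ℂ] B) → obj A → obj B
  map_add : ∀ {A B : Type} [NonUnitalCStarAlgebra A] [NonUnitalCStarAlgebra B]
    (φ : A →⋆ₙₐ[ℂ] B) (x y : obj A),
      letI := grp A
      letI := grp B
      map φ (x + y) = map φ x + map φ y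
  map_id : ∀ {A : Type} [NonUnitalCStarAlgebra A] (φ : A →⋆ₙₐ[ℂ] A),
    (∀ a, φ a = a) → ∀ x, map φ x = x
  map_comp : ∀ {A B C : Type} [NonUnitalCStarAlgebra A] [NonUnitalCStarAlgebra B]
    [NonUnitalCStarAlgebra C] (φ : A →⋆ₙₐ[ℂ] B) (ψ : B →⋆ₙₐ[ℂ] C) (x : obj A),
      map (ψ.comp φ) x = map ψ (map φ x)

attribute [instance] AbFunctor.grp

/-- The first coordinate projection as a *-homomorphism. -/
def fstHom (A B : Type*) [NonUnitalCStarAlgebra A] [NonUnitalCStarAlgebra B] :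
    (A × B) →⋆ₙₐ[ℂ] A where
  toFun := Prod.fst
  map_smul' _ _ := rfl
  map_zero' := rfl
  map_add' _ _ := rfl
  map_mul' _ _ := rfl
  map_star' _ := rfl

/-- The second coordinate projection as a *-homomorphism. -/
def sndHom (A B : Type*) [NonUnitalCStarAlgebra A] [NonUnitalCStarAlgebra B] :
    (A × B) →⋆ₙₐ[ℂ] B where
  toFun := Prod.snd
  map_smul' _ _ := rfl
  map_zero' := rfl
  map_add' _ _ := rfl
  map_mul' _ _ := rfl
  map_star' _ := rfl

/-- Additivity: `F(A ⊕ B) ≅ F(A) × F(B)` via the coordinate projections. -/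
def AbFunctor.Additive (F : AbFunctor) : Prop :=
  ∀ (A B : Type) [NonUnitalCStarAlgebra A] [NonUnitalCStarAlgebra B],
    Function.Bijective fun x : F.obj (A × B) => (F.map (fstHom A B) x, F.map (sndHom A B) x)

/-- Homotopy invariance. -/
def AbFunctor.HomotopyInvariant (F : AbFunctor) : Prop :=
  ∀ (A B : Type) [NonUnitalCStarAlgebra A] [NonUnitalCStarAlgebra B] (φ ψ : A →⋆ₙₐ[ℂ] B),
    (∃ Φ : A →⋆ₙₐ[ℂ] C(I, B), (∀ a, Φ a 0 = φ a) ∧ (∀ a, Φ a 1 = ψ a)) →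
    ∀ x, F.map φ x = F.map ψ x

/-- Half-exactness. -/
def AbFunctor.HalfExact (F : AbFunctor) : Prop :=
  ∀ (A₀ A₁ A₂ : Type) [NonUnitalCStarAlgebra A₀] [NonUnitalCStarAlgebra A₁]
    [NonUnitalCStarAlgebra A₂] (ι : A₀ →⋆ₙₐ[ℂ] A₁) (π : A₁ →⋆ₙₐ[ℂ] A₂),
    IsShortExact ι π → ∀ y : F.obj A₁, (∃ x, F.map ι x = y) ↔ F.map π y = 0


section Helpers

/-- `C(I, φ)`-free suspension of a *-homomorphism. -/
def suspMapAux {X Y : Type} [NonUnitalCStarAlgebra X] [NonUnitalCStarAlgebra Y]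
    (φ : X →⋆ₙₐ[ℂ] Y) : ↥(susp X) →⋆ₙₐ[ℂ] ↥(susp Y) where
  toFun g := ⟨⟨fun s => φ (g.val s), (map_continuous φ).comp g.val.continuous⟩,
    ⟨by show φ (g.val 0) = 0; rw [g.2.1, map_zero], by show φ (g.val 1) = 0; rw [g.2.2, map_zero]⟩⟩
  map_smul' c g := Subtype.ext (ContinuousMap.ext fun s => map_smul φ c (g.val s))
  map_zero' := Subtype.ext (ContinuousMap.ext fun s => map_zero φ)
  map_add' g h := Subtype.ext (ContinuousMap.ext fun s => map_add φ (g.val s) (h.val s))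
  map_mul' g h := Subtype.ext (ContinuousMap.ext fun s => map_mul φ (g.val s) (h.val s))
  map_star' g := Subtype.ext (ContinuousMap.ext fun s => map_star φ (g.val s))

/-- The standard contraction of the cone. -/
def coneContr (A : Type) [NonUnitalCStarAlgebra A] : ↥(cone A) →⋆ₙₐ[ℂ] C(I, ↥(cone A)) where
  toFun f := ⟨fun s => ⟨⟨fun t => f.val (s * t), by fun_prop⟩,
      by show f.val (s * 0) = 0; rw [mul_zero]; exact f.2⟩,
    Continuous.subtype_mk (ContinuousMap.continuous_of_continuous_uncurry _
      (by show Continuous fun p : I × I => f.val (p.1 * p.2); fun_prop)) _⟩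
  map_smul' _ _ := rfl
  map_zero' := rfl
  map_add' _ _ := rfl
  map_mul' _ _ := rfl
  map_star' _ := rfl

/-- Suspension of a homotopy. -/
def suspContr {K : Type} [NonUnitalCStarAlgebra K] (H : K →⋆ₙₐ[ℂ] C(I, K)) :
    ↥(susp K) →⋆ₙₐ[ℂ] C(I, ↥(susp K)) where
  toFun g := ⟨fun s => ⟨⟨fun u => H (g.val u) s,
        (continuous_eval_const s).comp ((map_continuous H).comp g.val.continuous)⟩,
      ⟨by show H (g.val 0) s = 0; rw [g.2.1, map_zero]; rfl,
       by show H (g.val 1) s = 0; rw [g.2.2, map_zero]; rfl⟩⟩,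
    Continuous.subtype_mk (ContinuousMap.continuous_of_continuous_uncurry _
      (by
        show Continuous fun p : I × I => H (g.val p.2) p.1
        have h : Continuous fun u : I => H (g.val u) := (map_continuous H).comp g.val.continuous
        exact (h.comp continuous_snd).eval continuous_fst)) _⟩
  map_smul' c g := ContinuousMap.ext fun s => Subtype.ext (ContinuousMap.ext fun u =>
    congrArg (fun k : C(I, K) => k s) (map_smul H c (g.val u)))
  map_zero' := ContinuousMap.ext fun s => Subtype.ext (ContinuousMap.ext fun u =>
    congrArg (fun k : C(I, K) => k s) (map_zero H))
  map_add' g h := ContinuousMap.ext fun s => Subtype.ext (ContinuousMap.ext fun u =>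
    congrArg (fun k : C(I, K) => k s) (map_add H (g.val u) (h.val u)))
  map_mul' g h := ContinuousMap.ext fun s => Subtype.ext (ContinuousMap.ext fun u =>
    congrArg (fun k : C(I, K) => k s) (map_mul H (g.val u) (h.val u)))
  map_star' g := ContinuousMap.ext fun s => Subtype.ext (ContinuousMap.ext fun u =>
    congrArg (fun k : C(I, K) => k s) (map_star H (g.val u)))

/-- The diagonal `x ↦ (x,x)` from the cone to the mapping cone of `ev₁`. -/
def coneDiag (A : Type) [NonUnitalCStarAlgebra A] :
    ↥(cone A) →⋆ₙₐ[ℂ] ↥(mapCone (coneEval A)) where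
  toFun x := ⟨(x, x.val), ⟨x.2, rfl⟩⟩
  map_smul' _ _ := rfl
  map_zero' := rfl
  map_add' _ _ := rfl
  map_mul' _ _ := rfl
  map_star' _ := rfl

/-- The sum of two orthogonal *-homomorphisms on a direct sum. -/
def orthSum {X Y : Type} [NonUnitalCStarAlgebra X] [NonUnitalCStarAlgebra Y]
    (a b : X →⋆ₙₐ[ℂ] Y) (hab : ∀ x y, a x * b y = 0) (hba : ∀ x y, b x * a y = 0) :
    (X × X) →⋆ₙₐ[ℂ] Y where
  toFun p := a p.1 + b p.2
  map_smul' c p := by simp [map_smul, smul_add]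
  map_zero' := by simp
  map_add' p q := by simp only [Prod.fst_add, Prod.snd_add, map_add]; abel
  map_mul' p q := by simp [map_mul, add_mul, mul_add, hab, hba]
  map_star' p := by simp [map_star, star_add]

lemma map_congr_fun (F : AbFunctor) {X Y : Type} [NonUnitalCStarAlgebra X]
    [NonUnitalCStarAlgebra Y] {a b : X →⋆ₙₐ[ℂ] Y} (h : ∀ x, a x = b x) (x : F.obj X) :
    F.map a x = F.map b x := by
  rw [show a = b from NonUnitalStarAlgHom.ext h]

lemma map_zero_elt (F : AbFunctor) {X Y : Type} [NonUnitalCStarAlgebra X]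
    [NonUnitalCStarAlgebra Y] (a : X →⋆ₙₐ[ℂ] Y) : F.map a 0 = 0 := by
  have h := F.map_add a 0 0
  simpa using h

lemma map_inl_snd (F : AbFunctor) (hHX : F.HalfExact) {X Y : Type} [NonUnitalCStarAlgebra X]
    [NonUnitalCStarAlgebra Y] (x : F.obj X) :
    F.map (sndHom X Y) (F.map (NonUnitalStarAlgHom.inl ℂ X Y) x) = 0 := by
  refine (hHX X (X × Y) Y (NonUnitalStarAlgHom.inl ℂ X Y) (sndHom X Y) ⟨?_, ?_, ?_⟩ _).1 ⟨x, rfl⟩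
  · intro u v h; exact congrArg Prod.fst h
  · intro y; exact ⟨(0, y), rfl⟩
  · ext ⟨u, v⟩
    constructor
    · rintro ⟨w, hw⟩; exact (congrArg Prod.snd hw).symm
    · intro h; exact ⟨u, Prod.ext rfl (Eq.symm h)⟩

lemma map_of_zero (F : AbFunctor) (hHX : F.HalfExact) {X Y : Type} [NonUnitalCStarAlgebra X]
    [NonUnitalCStarAlgebra Y] (a : X →⋆ₙₐ[ℂ] Y) (ha : ∀ x, a x = 0) (x : F.obj X) :
    F.map a x = 0 := by
  rw [← map_inl_snd F hHX (Y := Y) x, ← F.map_comp]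
  exact map_congr_fun F (fun u => ha u) x

lemma contractible_zero (F : AbFunctor) (hHtpy : F.HomotopyInvariant) (hHX : F.HalfExact)
    {K : Type} [NonUnitalCStarAlgebra K] (H : K →⋆ₙₐ[ℂ] C(I, K)) (h0 : ∀ a, H a 0 = 0)
    (h1 : ∀ a, H a 1 = a) (x : F.obj K) : x = 0 := by
  have h := hHtpy K K 0 (NonUnitalStarAlgHom.id ℂ K) ⟨H, h0, h1⟩ x
  rw [F.map_id (NonUnitalStarAlgHom.id ℂ K) (fun _ => rfl), map_of_zero F hHX 0 (fun _ => rfl)] at h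
  exact h.symm

lemma map_orth (F : AbFunctor) (hAdd : F.Additive) (hHX : F.HalfExact) {X Y : Type}
    [NonUnitalCStarAlgebra X] [NonUnitalCStarAlgebra Y]
    (a b d : X →⋆ₙₐ[ℂ] Y) (hab : ∀ x y, a x * b y = 0) (hba : ∀ x y, b x * a y = 0)
    (hd : ∀ x, d x = a x + b x) (x : F.obj X) : F.map d x = F.map a x + F.map b x := by
  let δ : X →⋆ₙₐ[ℂ] X × X :=
    (NonUnitalStarAlgHom.id ℂ X).prod (NonUnitalStarAlgHom.id ℂ X)
  have key : F.map δ x = F.map (NonUnitalStarAlgHom.inl ℂ X X) x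
      + F.map (NonUnitalStarAlgHom.inr ℂ X X) x := by
    apply (hAdd X X).1
    refine Prod.ext ?_ ?_
    · show F.map (fstHom X X) _ = F.map (fstHom X X) _
      rw [F.map_add, ← F.map_comp, ← F.map_comp, ← F.map_comp, F.map_id _ (fun _ => rfl),
        F.map_id _ (fun _ => rfl), map_of_zero F hHX _ (fun _ => rfl), add_zero]
    · show F.map (sndHom X X) _ = F.map (sndHom X X) _
      rw [F.map_add, ← F.map_comp, ← F.map_comp, ← F.map_comp, F.map_id _ (fun _ => rfl),
        map_of_zero F hHX _ (fun _ => rfl), F.map_id _ (fun _ => rfl), zero_add]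
  have h := congrArg (F.map (orthSum a b hab hba)) key
  rw [F.map_add, ← F.map_comp, ← F.map_comp, ← F.map_comp] at h
  rw [map_congr_fun F (b := (orthSum a b hab hba).comp δ) (fun u => hd u), h]
  congr 1
  · exact map_congr_fun F (fun u => by
      show a u + b 0 = a u
      simp) x
  · exact map_congr_fun F (fun u => by
      show a 0 + b u = b u
      simp) x

lemma map_neg_of_factor (F : AbFunctor) (hAdd : F.Additive) (hHX : F.HalfExact) {X Y K : Type}
    [NonUnitalCStarAlgebra X] [NonUnitalCStarAlgebra Y] [NonUnitalCStarAlgebra K]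
    (hK : ∀ x : F.obj K, x = 0)
    (a b : X →⋆ₙₐ[ℂ] Y) (c : X →⋆ₙₐ[ℂ] K) (e : K →⋆ₙₐ[ℂ] Y)
    (hab : ∀ x y, a x * b y = 0) (hba : ∀ x y, b x * a y = 0)
    (hd : ∀ x, e (c x) = a x + b x) (x : F.obj X) : F.map a x = - F.map b x := by
  have h := map_orth F hAdd hHX a b (e.comp c) hab hba hd x
  rw [F.map_comp, hK (F.map c x), map_zero_elt] at h
  exact eq_neg_of_add_eq_zero_left h.symm

end Helpers

section Helpers2

lemma map_susp_neg_of_factor (F : AbFunctor) (hAdd : F.Additive) (hHX : F.HalfExact) {X Y K : Type}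
    [NonUnitalCStarAlgebra X] [NonUnitalCStarAlgebra Y] [NonUnitalCStarAlgebra K]
    (hK : ∀ x : F.obj ↥(susp K), x = 0)
    (a b : X →⋆ₙₐ[ℂ] Y) (c : X →⋆ₙₐ[ℂ] K) (e : K →⋆ₙₐ[ℂ] Y)
    (hab : ∀ x y, a x * b y = 0) (hba : ∀ x y, b x * a y = 0)
    (hd : ∀ x, e (c x) = a x + b x)
    (Sa Sb : ↥(susp X) →⋆ₙₐ[ℂ] ↥(susp Y))
    (hSa : ∀ g s, (Sa g).val s = a (g.val s)) (hSb : ∀ g s, (Sb g).val s = b (g.val s))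
    (x : F.obj ↥(susp X)) :
    F.map Sa x = - (F.map Sb x : F.obj ↥(susp Y)) := by
  refine map_neg_of_factor F hAdd hHX hK Sa Sb (suspMapAux c) (suspMapAux e) ?_ ?_ ?_ x
  · intro x y
    refine Subtype.ext (ContinuousMap.ext fun s => ?_)
    show (Sa x).val s * (Sb y).val s = 0
    rw [hSa, hSb, hab]
  · intro x y
    refine Subtype.ext (ContinuousMap.ext fun s => ?_)
    show (Sb x).val s * (Sa y).val s = 0
    rw [hSa, hSb, hba]
  · intro x
    refine Subtype.ext (ContinuousMap.ext fun s => ?_)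
    show e (c (x.val s)) = (Sa x).val s + (Sb x).val s
    rw [hSa, hSb, hd]

lemma cone_zero (F : AbFunctor) (hHtpy : F.HomotopyInvariant) (hHX : F.HalfExact)
    (A : Type) [NonUnitalCStarAlgebra A] : ∀ x : F.obj ↥(cone A), x = 0 :=
  contractible_zero F hHtpy hHX (coneContr A)
    (fun a => Subtype.ext (ContinuousMap.ext fun t => by
      show a.val (0 * t) = 0
      rw [zero_mul]; exact a.2))
    (fun a => Subtype.ext (ContinuousMap.ext fun t => by
      show a.val (1 * t) = a.val t
      rw [one_mul]))

lemma susp_zero (F : AbFunctor) (hHtpy : F.HomotopyInvariant) (hHX : F.HalfExact)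
    {K : Type} [NonUnitalCStarAlgebra K] (H : K →⋆ₙₐ[ℂ] C(I, K)) (h0 : ∀ a, H a 0 = 0)
    (h1 : ∀ a, H a 1 = a) : ∀ x : F.obj ↥(susp K), x = 0 :=
  contractible_zero F hHtpy hHX (suspContr H)
    (fun a => Subtype.ext (ContinuousMap.ext fun u => h0 (a.val u)))
    (fun a => Subtype.ext (ContinuousMap.ext fun u => h1 (a.val u)))

lemma susp_cone_zero (F : AbFunctor) (hHtpy : F.HomotopyInvariant) (hHX : F.HalfExact)
    (A : Type) [NonUnitalCStarAlgebra A] : ∀ x : F.obj ↥(susp ↥(cone A)), x = 0 :=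
  susp_zero F hHtpy hHX (coneContr A)
    (fun a => Subtype.ext (ContinuousMap.ext fun t => by
      show a.val (0 * t) = 0
      rw [zero_mul]; exact a.2))
    (fun a => Subtype.ext (ContinuousMap.ext fun t => by
      show a.val (1 * t) = a.val t
      rw [one_mul]))

end Helpers2

section Helpers3

lemma orth_left (A : Type) [NonUnitalCStarAlgebra A]
    (f : ↥(susp A) →⋆ₙₐ[ℂ] ↥(mapCone (coneEval A)))
    (hf : ∀ g : ↥(susp A), ((f g).val.1 : C(I, A)) = g.val ∧ (f g).val.2 = 0)
    (x y : ↥(susp A)) : f x * mapConeIncl (coneEval A) y = 0 :=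
  Subtype.ext (Prod.ext (mul_zero _) (by
    show (f x).val.2 * y.val = 0
    rw [(hf x).2, zero_mul]))

lemma orth_right (A : Type) [NonUnitalCStarAlgebra A]
    (f : ↥(susp A) →⋆ₙₐ[ℂ] ↥(mapCone (coneEval A)))
    (hf : ∀ g : ↥(susp A), ((f g).val.1 : C(I, A)) = g.val ∧ (f g).val.2 = 0)
    (x y : ↥(susp A)) : mapConeIncl (coneEval A) x * f y = 0 :=
  Subtype.ext (Prod.ext (zero_mul _) (by
    show x.val * (f y).val.2 = 0
    rw [(hf y).2, mul_zero]))

lemma diag_eq (A : Type) [NonUnitalCStarAlgebra A]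
    (f : ↥(susp A) →⋆ₙₐ[ℂ] ↥(mapCone (coneEval A)))
    (hf : ∀ g : ↥(susp A), ((f g).val.1 : C(I, A)) = g.val ∧ (f g).val.2 = 0)
    (x : ↥(susp A)) : coneDiag A (suspIncl A x) = f x + mapConeIncl (coneEval A) x :=
  Subtype.ext (Prod.ext (Subtype.ext (by
    show x.val = ((f x).val.1 : C(I, A)) + 0
    rw [(hf x).1, add_zero])) (by
    show x.val = (f x).val.2 + x.val
    rw [(hf x).2, zero_add]))

end Helpers3

/-- The six-term sequence of the cone extension `SA → CA → A`
(covariant case): `F(CA)` and `F(S(CA))` vanish, `F(f) = -F(ι_mc)`, and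
`F(Sf) = -F(Sι_mc)`. -/
theorem statement7 (F : AbFunctor)
    (hAdd : F.Additive) (hHtpy : F.HomotopyInvariant) (hHX : F.HalfExact)
    (A : Type) [NonUnitalCStarAlgebra A]
    -- `f : SA → C_{ev₁}`, `g ↦ (g, 0)`
    (f : ↥(susp A) →⋆ₙₐ[ℂ] ↥(mapCone (coneEval A)))
    (hf : ∀ g : ↥(susp A), ((f g).val.1 : C(I, A)) = g.val ∧ (f g).val.2 = 0)
    -- `Sf : S(SA) → S(C_{ev₁})`, the suspension of `f`
    (Sf : ↥(susp ↥(susp A)) →⋆ₙₐ[ℂ] ↥(susp ↥(mapCone (coneEval A))))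
    (hSf : ∀ g s, (Sf g).val s = f (g.val s))
    -- `Sι_mc : S(SA) → S(C_{ev₁})`, the suspension of `ι_mc : g ↦ (0, g)`
    (Sι : ↥(susp ↥(susp A)) →⋆ₙₐ[ℂ] ↥(susp ↥(mapCone (coneEval A))))
    (hSι : ∀ g s, (Sι g).val s = mapConeIncl (coneEval A) (g.val s)) :
    -- (1) `F(CA)` and `F(S(CA))` are trivial
    (∀ x y : F.obj ↥(cone A), x = y) ∧
    (∀ x y : F.obj ↥(susp ↥(cone A)), x = y) ∧
    -- (2) `F(f) = -F(ι_mc)`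
    (∀ x : F.obj ↥(susp A), F.map f x
      = - (F.map (mapConeIncl (coneEval A)) x : F.obj ↥(mapCone (coneEval A)))) ∧
    -- (3) `F(Sf) = -F(Sι_mc)`
    ∀ x : F.obj ↥(susp ↥(susp A)), F.map Sf x = - (F.map Sι x : F.obj ↥(susp ↥(mapCone (coneEval A)))) := by
  have hC := cone_zero F hHtpy hHX A
  have hSC := susp_cone_zero F hHtpy hHX A
  refine ⟨fun x y => (hC x).trans (hC y).symm, fun x y => (hSC x).trans (hSC y).symm, ?_, ?_⟩
  · intro x
    exact map_neg_of_factor F hAdd hHX (X := ↥(susp A)) (Y := ↥(mapCone (coneEval A)))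
      (K := ↥(cone A)) hC f (mapConeIncl (coneEval A)) (suspIncl A) (coneDiag A)
      (orth_left A f hf) (orth_right A f hf) (diag_eq A f hf) x
  · intro x
    exact map_susp_neg_of_factor F hAdd hHX (X := ↥(susp A)) (Y := ↥(mapCone (coneEval A)))
      (K := ↥(cone A)) hSC f (mapConeIncl (coneEval A)) (suspIncl A) (coneDiag A)
      (orth_left A f hf) (orth_right A f hf) (diag_eq A f hf) Sf Sι hSf hSι x

/- Performance only: when the compiled file is written, the system indexes the (very large) type of every non-deprecated theorem
for library suggestions, which takes extremely long for this statement. Marking the theorem as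
deprecated skips that indexing and changes neither its type nor its proof. -/
attribute [deprecated] statement7

end CStarPaper
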